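/- arXiv:2601.01911 — 2 statements merged into one kernel-verified Lean document; each statement's English description precedes it below -/
import Mathlib

section
/- Let ε_1, ε_2, ε_3, ε_4, ε_5 ∈ {+1, −1}. Let M be the 10×10 real symmetric matrix with zero diagonal, indexed by {y_1, …, y_6, x_1, x_2, x_1', x_2'}, whose nonzero off-diagonal entries (given symmetrically) are: M(y_1,y_2) = M(y_2,y_3) = M(y_3,y_4) = M(y_4,y_5) = M(y_5,y_6) = M(y_6,y_1) = 1, M(x_1,y_1) = ε_1, M(x_2,y_2) = ε_2, M(x_1,x_1') = ε_3, M(x_2,x_2') = ε_4, M(x_1',x_2') = ε_5. Then M has exactly 5 negative eigenvalues, counted with multiplicity. (M is the signed adjacency matrix of the signed graph (B(6,2,6),σ): a positively-signed 6-cycle y_1y_2y_3y_4y_5y_6 together with the path y_1x_1x_1'x_2'x_2y_2 attached at the adjacent cycle vertices y_1, y_2, with arbitrary signs on the five non-cycle edges.) -/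
noncomputable section

/-- Upper-triangular entry pattern of the signed adjacency matrix of `(B(6,2,6),σ)`:
a positive 6-cycle `y₁y₂y₃y₄y₅y₆` (indices `0 1 2 3 4 5`) together with the path
`y₁x₁x₁'x₂'x₂y₂`, where `x₁ = 6, x₂ = 7, x₁' = 8, x₂' = 9`. -/
def ent13 (e1 e2 e3 e4 e5 : ℝ) : Fin 10 → Fin 10 → ℝ := fun i j =>
  if i = 0 ∧ j = 1 then 1 else
  if i = 1 ∧ j = 2 then 1 else
  if i = 2 ∧ j = 3 then 1 else
  if i = 3 ∧ j = 4 then 1 else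
  if i = 4 ∧ j = 5 then 1 else
  if i = 5 ∧ j = 0 then 1 else
  if i = 6 ∧ j = 0 then e1 else
  if i = 7 ∧ j = 1 then e2 else
  if i = 6 ∧ j = 8 then e3 else
  if i = 7 ∧ j = 9 then e4 else
  if i = 8 ∧ j = 9 then e5 else 0

/-- The symmetric matrix `M` of STATEMENT 13. -/
def M13 (e1 e2 e3 e4 e5 : ℝ) : Matrix (Fin 10) (Fin 10) ℝ :=
  Matrix.of fun i j => ent13 e1 e2 e3 e4 e5 i j + ent13 e1 e2 e3 e4 e5 j i

lemma roots13 (f : Fin 10 → ℝ) :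
    (∏ i, (Polynomial.X - Polynomial.C (f i))).roots = Finset.univ.val.map f := by
  have := Polynomial.roots_multiset_prod_X_sub_C (Finset.univ.val.map f)
  rw [Multiset.map_map] at this
  exact this

/-- Signs of the bipartition. -/
def sgn13 : Fin 10 → ℝ := ![1, -1, 1, -1, 1, -1, -1, 1, 1, -1]

lemma sgn13_mul (e1 e2 e3 e4 e5 : ℝ) (i j : Fin 10) :
    sgn13 i * M13 e1 e2 e3 e4 e5 i j * sgn13 j = - M13 e1 e2 e3 e4 e5 i j := by
  fin_cases i <;> fin_cases j <;> simp [sgn13, M13, ent13]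

lemma sgn13_sq (i : Fin 10) : sgn13 i * sgn13 i = 1 := by
  fin_cases i <;> simp [sgn13]

lemma conj13 (e1 e2 e3 e4 e5 x : ℝ) :
    Matrix.diagonal sgn13 * (Matrix.scalar (Fin 10) x - M13 e1 e2 e3 e4 e5) * Matrix.diagonal sgn13
      = -(Matrix.scalar (Fin 10) (-x) - M13 e1 e2 e3 e4 e5) := by
  ext i j
  rw [Matrix.mul_diagonal, Matrix.diagonal_mul]
  have h := sgn13_mul e1 e2 e3 e4 e5 i j
  by_cases hij : i = j
  · subst hij
    have := sgn13_sq i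
    simp
    linear_combination x * this - h
  · simp [hij]
    linear_combination -h

lemma det13 (e1 e2 e3 e4 e5 x : ℝ) :
    (Matrix.scalar (Fin 10) x - M13 e1 e2 e3 e4 e5).det =
      (Matrix.scalar (Fin 10) (-x) - M13 e1 e2 e3 e4 e5).det := by
  have h := congrArg Matrix.det (conj13 e1 e2 e3 e4 e5 x)
  rw [Matrix.det_mul, Matrix.det_mul, Matrix.det_neg] at h
  have hd : (Matrix.diagonal sgn13).det * (Matrix.diagonal sgn13).det = 1 := by
    rw [Matrix.det_diagonal, ← Finset.prod_mul_distrib]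
    simp [sgn13_sq]
  have h10 : ((-1 : ℝ)) ^ Fintype.card (Fin 10) = 1 := by norm_num
  rw [h10] at h
  linear_combination h - (Matrix.scalar (Fin 10) x - M13 e1 e2 e3 e4 e5).det * hd

lemma sum13 (f : Fin 10 → ℝ) :
    ∑ i, f i = f 0 + f 1 + f 2 + f 3 + f 4 + f 5 + f 6 + f 7 + f 8 + f 9 := by
  rw [Fin.sum_univ_castSucc, Fin.sum_univ_castSucc, Fin.sum_univ_eight]
  rfl

set_option maxHeartbeats 4000000 in
lemma det13_ne (e1 e2 e3 e4 e5 : ℝ)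
    (h1 : e1 = 1 ∨ e1 = -1) (h2 : e2 = 1 ∨ e2 = -1) (h3 : e3 = 1 ∨ e3 = -1)
    (h4 : e4 = 1 ∨ e4 = -1) (h5 : e5 = 1 ∨ e5 = -1) :
    (M13 e1 e2 e3 e4 e5).det ≠ 0 := by
  intro h0
  obtain ⟨v, hv, hMv⟩ := Matrix.exists_mulVec_eq_zero_iff.mpr h0
  apply hv
  have r0 := congrFun hMv 0
  have r1 := congrFun hMv 1
  have r2 := congrFun hMv 2
  have r3 := congrFun hMv 3
  have r4 := congrFun hMv 4
  have r5 := congrFun hMv 5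
  have r6 := congrFun hMv 6
  have r7 := congrFun hMv 7
  have r8 := congrFun hMv 8
  have r9 := congrFun hMv 9
  simp [Matrix.mulVec, dotProduct, sum13, M13, ent13]
    at r0 r1 r2 r3 r4 r5 r6 r7 r8 r9
  ext i
  rcases h1 with rfl | rfl <;> rcases h2 with rfl | rfl <;> rcases h3 with rfl | rfl <;>
    rcases h4 with rfl | rfl <;> rcases h5 with rfl | rfl <;> fin_cases i <;> simp <;> linarith

/-- the matrix `M` has exactly 5 negative eigenvalues. -/
theorem stmt_13 (e1 e2 e3 e4 e5 : ℝ)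
    (h1 : e1 = 1 ∨ e1 = -1) (h2 : e2 = 1 ∨ e2 = -1) (h3 : e3 = 1 ∨ e3 = -1)
    (h4 : e4 = 1 ∨ e4 = -1) (h5 : e5 = 1 ∨ e5 = -1)
    (hM : (M13 e1 e2 e3 e4 e5).IsHermitian) :
    (Finset.univ.filter fun i => hM.eigenvalues i < 0).card = 5 := by
  have hdet := det13_ne e1 e2 e3 e4 e5 h1 h2 h3 h4 h5
  have hne : ∀ i, hM.eigenvalues i ≠ 0 := by
    intro i hi
    apply hdet
    rw [hM.det_eq_prod_eigenvalues]
    exact Finset.prod_eq_zero (Finset.mem_univ i) (by simp [hi])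
  have hc : (M13 e1 e2 e3 e4 e5).charpoly =
      ∏ i, (Polynomial.X - Polynomial.C (hM.eigenvalues i)) := by
    simpa using hM.charpoly_eq
  have hev : ∀ x : ℝ, (Matrix.scalar (Fin 10) x - M13 e1 e2 e3 e4 e5).det =
      ∏ i, (x - hM.eigenvalues i) := by
    intro x
    rw [← Matrix.eval_charpoly, hc, Polynomial.eval_prod]
    simp
  have hpoly : ∏ i, (Polynomial.X - Polynomial.C (hM.eigenvalues i)) =
      ∏ i, (Polynomial.X - Polynomial.C (-hM.eigenvalues i)) := by
    apply Polynomial.funext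
    intro x
    have h := det13 e1 e2 e3 e4 e5 x
    rw [hev, hev] at h
    rw [Polynomial.eval_prod, Polynomial.eval_prod]
    simp only [Polynomial.eval_sub, Polynomial.eval_X, Polynomial.eval_C]
    rw [h]
    have : ∀ i, -x - hM.eigenvalues i = -1 * (x - -hM.eigenvalues i) := by intro i; ring
    simp only [this]
    rw [Finset.prod_mul_distrib]
    norm_num
  have hroots := congrArg Polynomial.roots hpoly
  rw [roots13, roots13] at hroots
  have hcount := congrArg (Multiset.countP (fun x : ℝ => x < 0)) hroots
  rw [Multiset.countP_map, Multiset.countP_map] at hcount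
  have hcard : (Finset.univ.filter fun i => hM.eigenvalues i < 0).card =
      (Finset.univ.filter fun i => ¬ hM.eigenvalues i < 0).card := by
    have e : (Finset.univ.filter fun i => ¬ hM.eigenvalues i < 0) =
        (Finset.univ.filter fun i => - hM.eigenvalues i < 0) := by
      ext i
      have := hne i
      simp only [Finset.mem_filter, Finset.mem_univ, true_and, not_lt, neg_lt_zero]
      exact ⟨fun h => lt_of_le_of_ne h this.symm, le_of_lt⟩
    rw [e]
    exact hcount
  have hsum := Finset.card_filter_add_card_filter_not (s := (Finset.univ : Finset (Fin 10)))
    (fun i => hM.eigenvalues i < 0)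
  simp only [Finset.card_univ, Fintype.card_fin] at hsum
  omega

end
end

section
/- Let a, b, c ≥ 0 be integers, and let Γ_5 be the signed graph constructed as follows: take a 6-cycle C with vertices in cyclic order y_1, y_4, y_3, y_6, y_2, y_5, all six cycle edges signed +1; attach a pendant vertex x_i adjacent to y_i for i = 1, 2, 3; add a vertex x' adjacent to x_1, x_2, x_3; and attach a, b, c additional pendant vertices adjacent to y_1, y_2, y_3 respectively; all edges not on C carry arbitrary signs. Then i_-(Γ_5) = 4 = ⌈6/2⌉ + 1. -/
noncomputable section

/-- Vertex type of `Γ₅`: ten base vertices `y₁,…,y₆,x₁,x₂,x₃,x'` (as `Fin 10`, in this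
order), and `a`, `b`, `c` pendant vertices at `y₁`, `y₂`, `y₃` respectively. -/
abbrev V17 (a b c : ℕ) : Type := Fin 10 ⊕ (Fin a ⊕ (Fin b ⊕ Fin c))

/-- Half of the adjacency relation of `Γ₅` (each edge listed in one direction):
the 6-cycle `y₁y₄y₃y₆y₂y₅` (indices `0 3 2 5 1 4`), pendant edges `x₁y₁, x₂y₂, x₃y₃`,
edges `x'x₁, x'x₂, x'x₃`, and the `a`, `b`, `c` pendant edges at `y₁ = 0`, `y₂ = 1`,
`y₃ = 2`. -/
def half17 {a b c : ℕ} : V17 a b c → V17 a b c → Prop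
  | .inl i, .inl j =>
      (i = 0 ∧ j = 3) ∨ (i = 0 ∧ j = 4) ∨ (i = 1 ∧ j = 4) ∨ (i = 1 ∧ j = 5) ∨
      (i = 2 ∧ j = 3) ∨ (i = 2 ∧ j = 5) ∨ (i = 6 ∧ j = 0) ∨ (i = 7 ∧ j = 1) ∨
      (i = 8 ∧ j = 2) ∨ (i = 9 ∧ j = 6) ∨ (i = 9 ∧ j = 7) ∨ (i = 9 ∧ j = 8)
  | .inl i, .inr (.inl _) => i = 0
  | .inl i, .inr (.inr (.inl _)) => i = 1
  | .inl i, .inr (.inr (.inr _)) => i = 2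
  | _, _ => False

/-- The (symmetrized) adjacency relation of `Γ₅`. -/
def adj17 {a b c : ℕ} (u v : V17 a b c) : Prop := half17 u v ∨ half17 v u

/-- The negative inertia index of a real symmetric matrix: the number of negative
eigenvalues counted with multiplicity. -/
noncomputable def negInertia {n : Type} [Fintype n] [DecidableEq n]
    {A : Matrix n n ℝ} (hA : A.IsHermitian) : ℕ :=
  (Finset.univ.filter fun i => hA.eigenvalues i < 0).card

/-- Charpoly of the negative of a Hermitian matrix. -/
theorem charpoly_neg_aux {n : Type} [Fintype n] [DecidableEq n]
    {A : Matrix n n ℝ} (hA : A.IsHermitian) :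
    (-A).charpoly = ∏ i, (Polynomial.X - Polynomial.C (-(hA.eigenvalues i))) := by
  have h : -A = (hA.eigenvectorUnitary : Matrix n n ℝ) *
      Matrix.diagonal (fun i => -(hA.eigenvalues i)) *
      (star hA.eigenvectorUnitary : Matrix n n ℝ) := by
    conv_lhs => rw [hA.spectral_theorem, Unitary.conjStarAlgAut_apply]
    rw [← Matrix.neg_mul, ← Matrix.mul_neg, Matrix.diagonal_neg]
    rfl
  rw [h, Matrix.charpoly_mul_comm, ← mul_assoc]
  simp [Matrix.charpoly_diagonal]

/-- If `A` and `-A` have the same charpoly then the rank is twice the negative inertia. -/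
theorem rank_eq_two_mul {n : Type} [Fintype n] [DecidableEq n]
    {A : Matrix n n ℝ} (hA : A.IsHermitian) (h : (-A).charpoly = A.charpoly) :
    A.rank = 2 * negInertia hA := by
  have h1 : (-A).charpoly.roots = Multiset.map (fun i => -(hA.eigenvalues i)) Finset.univ.val := by
    rw [charpoly_neg_aux hA, Polynomial.roots_prod]
    · simp only [Polynomial.roots_X_sub_C, Multiset.bind_singleton]
    · simp only [Finset.prod_ne_zero_iff]
      intro i _
      exact Polynomial.X_sub_C_ne_zero _
  have h2 := hA.roots_charpoly_eq_eigenvalues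
  rw [← h, h1] at h2
  have h3 := congrArg (Multiset.countP (fun x : ℝ => x < 0)) h2
  rw [Multiset.countP_map, Multiset.countP_map] at h3
  have h4 : (Finset.univ.filter fun i => 0 < hA.eigenvalues i).card = negInertia hA := by
    unfold negInertia
    simpa [Finset.card_def, Finset.filter_val] using h3
  rw [hA.rank_eq_card_non_zero_eigs, Fintype.card_subtype, two_mul]
  nth_rewrite 1 [← h4]
  unfold negInertia
  rw [← Finset.card_union_of_disjoint]
  · congr 1
    ext i
    simp only [Finset.mem_filter, Finset.mem_univ, true_and, Finset.mem_union]
    rw [ne_iff_lt_or_gt, or_comm]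
  · rw [Finset.disjoint_filter]
    intro i _ h h'
    linarith

/-- The bipartition side containing the vertices indexed 0, 1, 2, 9. -/
def side17 {a b c : ℕ} : V17 a b c → Bool
  | .inl i => decide (i = 0 ∨ i = 1 ∨ i = 2 ∨ i = 9)
  | .inr _ => false

theorem half17_side {a b c : ℕ} (u v : V17 a b c) (h : half17 u v) : side17 u = !side17 v := by
  rcases u with i | i | i | i <;> rcases v with j | j | j | j <;>
    simp only [half17] at h <;> simp only [side17]
  · rcases h with h|h|h|h|h|h|h|h|h|h|h|h <;> (obtain ⟨rfl, rfl⟩ := h; decide)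
  all_goals (subst h; decide)

theorem adj17_side {a b c : ℕ} (u v : V17 a b c) (h : adj17 u v) : side17 u = !side17 v := by
  rcases h with h | h
  · exact half17_side u v h
  · rw [half17_side v u h, Bool.not_not]

theorem card_side17 {a b c : ℕ} : Fintype.card {u : V17 a b c // side17 u = true} = 4 := by
  have e : {u : V17 a b c // side17 u = true} ≃ {i : Fin 10 // i = 0 ∨ i = 1 ∨ i = 2 ∨ i = 9} :=
    { toFun := fun u => match u with
        | ⟨.inl i, h⟩ => ⟨i, of_decide_eq_true h⟩
        | ⟨.inr _, h⟩ => absurd h (by simp [side17])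
      invFun := fun i => ⟨.inl i.1, decide_eq_true i.2⟩
      left_inv := by
        rintro ⟨u | u, h⟩
        · rfl
        · simp [side17] at h
      right_inv := fun i => rfl }
  rw [Fintype.card_congr e]
  decide

/-- The eight base vertices indexed 0 to 6 and 9. -/
def emb17 (a b c : ℕ) : Fin 8 → V17 a b c := fun i => .inl (![0,1,2,3,4,5,6,9] i)

theorem rank_add_le_aux {n : Type} [Fintype n] (A B : Matrix n n ℝ) :
    (A + B).rank ≤ A.rank + B.rank := by
  unfold Matrix.rank
  rw [Matrix.mulVecLin_add]
  refine le_trans (Submodule.finrank_mono ?_) (Submodule.finrank_add_le_finrank_add_finrank _ _)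
  rintro _ ⟨x, rfl⟩
  exact Submodule.add_mem_sup ⟨x, rfl⟩ ⟨x, rfl⟩

theorem rank_low17 {a b c : ℕ}
    (A : Matrix (V17 a b c) (V17 a b c) ℝ) (hsym : ∀ u v, A u v = A v u)
    (hone : ∀ u v, adj17 u v → A u v = 1 ∨ A u v = -1)
    (hzero : ∀ u v, ¬ adj17 u v → A u v = 0)
    (hc1 : A (.inl 0) (.inl 3) = 1) (hc2 : A (.inl 0) (.inl 4) = 1)
    (hc3 : A (.inl 1) (.inl 4) = 1) (hc4 : A (.inl 1) (.inl 5) = 1)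
    (hc5 : A (.inl 2) (.inl 3) = 1) (hc6 : A (.inl 2) (.inl 5) = 1) : 8 ≤ A.rank := by
  have hM : IsUnit (A.submatrix (emb17 a b c) (emb17 a b c)) := by
    rw [← Matrix.mulVec_injective_iff_isUnit, ← Matrix.coe_mulVecLin, ← LinearMap.ker_eq_bot,
      LinearMap.ker_eq_bot']
    intro v hv
    have hs : A (.inl 9) (.inl 6) ≠ 0 := by
      rcases hone (.inl 9) (.inl 6) (Or.inl (by simp [half17])) with h | h <;> rw [h] <;> norm_num
    have q : ∀ i j : Fin 10, ¬ adj17 (.inl i : V17 a b c) (.inl j) → A (.inl i) (.inl j) = 0 :=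
      fun i j => hzero _ _
    simp only [adj17, half17] at q
    have row : ∀ i, ∑ j, A (emb17 a b c i) (emb17 a b c j) * v j = 0 := fun i => congrFun hv i
    simp only [Fin.sum_univ_eight] at row
    have e0 : emb17 a b c 0 = .inl 0 := rfl
    have e1 : emb17 a b c 1 = .inl 1 := rfl
    have e2 : emb17 a b c 2 = .inl 2 := rfl
    have e3 : emb17 a b c 3 = .inl 3 := rfl
    have e4 : emb17 a b c 4 = .inl 4 := rfl
    have e5 : emb17 a b c 5 = .inl 5 := rfl
    have e6 : emb17 a b c 6 = .inl 6 := rfl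
    have e7 : emb17 a b c 7 = .inl 9 := rfl
    rw [e0, e1, e2, e3, e4, e5, e6, e7] at row
    have r0 := row 0
    have r1 := row 1
    have r2 := row 2
    have r3 := row 3
    have r4 := row 4
    have r5 := row 5
    have r6 := row 6
    have r7 := row 7
    clear row
    rw [e0] at r0
    rw [e1] at r1
    rw [e2] at r2
    rw [e3] at r3
    rw [e4] at r4
    rw [e5] at r5
    rw [e6] at r6
    rw [e7] at r7
    have hc1' := (hsym _ _).trans hc1
    have hc2' := (hsym _ _).trans hc2
    have hc3' := (hsym _ _).trans hc3
    have hc4' := (hsym _ _).trans hc4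
    have hc5' := (hsym _ _).trans hc5
    have hc6' := (hsym _ _).trans hc6
    have hs' := hsym (.inl 6) (.inl 9)
    simp (disch := decide) only [hc1, hc2, hc3, hc4, hc5, hc6, hc1', hc2', hc3', hc4', hc5', hc6',
      hs', q, zero_mul, one_mul, add_zero, zero_add] at r0 r1 r2 r3 r4 r5 r6 r7
    have v0 : v 0 = 0 := by linarith
    have v1 : v 1 = 0 := by linarith
    have v2 : v 2 = 0 := by linarith
    have v6 : v 6 = 0 := by simpa [hs] using r7
    rw [v0, mul_zero, zero_add] at r6
    have v7 : v 7 = 0 := by simpa [hs] using r6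
    rw [v6, mul_zero, add_zero] at r0
    have v3 : v 3 = 0 := by linarith
    have v4 : v 4 = 0 := by linarith
    have v5 : v 5 = 0 := by linarith
    ext i
    fin_cases i <;> assumption
  have h1 := Matrix.rank_of_isUnit _ hM
  have h2 := Matrix.rank_submatrix_le A (emb17 a b c) (emb17 a b c)
  simp only [Fintype.card_fin] at h1
  omega

/-- any signed graph `Γ₅` with underlying graph `adj17` whose six cycle
edges are signed `+1` (and arbitrary `±1` signs on all other edges) satisfies
`i₋(Γ₅) = 4 = ⌈6/2⌉ + 1`. -/
theorem stmt_17 (a b c : ℕ)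
    (A : Matrix (V17 a b c) (V17 a b c) ℝ) (hA : A.IsHermitian)
    (hone : ∀ u v, adj17 u v → A u v = 1 ∨ A u v = -1)
    (hzero : ∀ u v, ¬ adj17 u v → A u v = 0)
    (hc1 : A (.inl 0) (.inl 3) = 1) (hc2 : A (.inl 0) (.inl 4) = 1)
    (hc3 : A (.inl 1) (.inl 4) = 1) (hc4 : A (.inl 1) (.inl 5) = 1)
    (hc5 : A (.inl 2) (.inl 3) = 1) (hc6 : A (.inl 2) (.inl 5) = 1) :
    negInertia hA = 4 := by
  have hz : ∀ u v, side17 u = side17 v → A u v = 0 := by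
    intro u v h
    apply hzero
    intro h'
    have := adj17_side u v h'
    rw [h] at this
    cases hh : side17 v <;> simp [hh] at this
  have hsym : ∀ u v, A u v = A v u := fun u v => by
    have := hA.apply u v
    simpa using this.symm
  -- symmetric spectrum
  have hch : (-A).charpoly = A.charpoly := by
    let d : V17 a b c → ℝ := fun u => if side17 u then 1 else -1
    have e : -A = Matrix.diagonal d * A * Matrix.diagonal d := by
      ext u v
      rw [Matrix.mul_diagonal, Matrix.diagonal_mul, Matrix.neg_apply]
      by_cases h : side17 u = side17 v
      · rw [hz u v h]; simp
      · simp only [d]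
        cases hu : side17 u <;> cases hv : side17 v <;>
          first | exact absurd (hu.trans hv.symm) h | simp
    rw [e, Matrix.charpoly_mul_comm, ← mul_assoc, Matrix.diagonal_mul_diagonal]
    have : (fun i => d i * d i) = fun _ => (1 : ℝ) := by
      ext i
      simp only [d]
      split <;> norm_num
    rw [this, Matrix.diagonal_one, one_mul]
  have hr := rank_eq_two_mul hA hch
  -- upper bound
  have hup : A.rank ≤ 8 := by
    let p : V17 a b c → ℝ := fun u => if side17 u then 1 else 0
    have e : A = Matrix.diagonal p * A + A * Matrix.diagonal p := by
      ext u v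
      rw [Matrix.add_apply, Matrix.mul_diagonal, Matrix.diagonal_mul]
      by_cases h : side17 u = side17 v
      · rw [hz u v h]; simp
      · simp only [p]
        cases hu : side17 u <;> cases hv : side17 v <;>
          first | exact absurd (hu.trans hv.symm) h | simp
    have hp : (Matrix.diagonal p).rank = 4 := by
      rw [Matrix.rank_diagonal, ← card_side17 (a := a) (b := b) (c := c)]
      apply Fintype.card_congr
      apply Equiv.subtypeEquivRight
      intro u
      simp [p]
    have h1 := Matrix.rank_mul_le_left (Matrix.diagonal p) A
    have h2 := Matrix.rank_mul_le_right A (Matrix.diagonal p)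
    have h3 := rank_add_le_aux (Matrix.diagonal p * A) (A * Matrix.diagonal p)
    rw [← e] at h3
    omega
  -- lower bound
  have hlow : 8 ≤ A.rank := by
    exact rank_low17 A hsym hone hzero hc1 hc2 hc3 hc4 hc5 hc6
  omega

end
end
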